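/- If there exists an integer ζ ≥ 1 such that (H, G₁) satisfies Condition A with constant ζ and Condition B with constant ζ, then (H, G₁) is a Dehornoy structure: PP ⊆ P, G₁PG₁ ⊆ P, and G is the disjoint union of P, P⁻¹ and G₁. -/

import Mathlib

namespace GarsideOrder

variable {G : Type*} [Group G]

/-- `a ≤_R b` iff `b * a⁻¹ ∈ M`. -/
def leR (M : Submonoid G) (a b : G) : Prop := b * a⁻¹ ∈ M

/-- `a ≤_L b` iff `a⁻¹ * b ∈ M`. -/
def leL (M : Submonoid G) (a b : G) : Prop := a⁻¹ * b ∈ M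

/-- Right divisors (in `M`) of `a`. -/
def DivR (M : Submonoid G) (a : G) : Set G := {b : G | b ∈ M ∧ leR M b a}

/-- Left divisors (in `M`) of `a`. -/
def DivL (M : Submonoid G) (a : G) : Set G := {b : G | b ∈ M ∧ leL M b a}

/-- `a` is balanced if its sets of right and left divisors coincide. -/
def Balanced (M : Submonoid G) (a : G) : Prop := DivR M a = DivL M a

open Classical in
/-- The `N`-tail of `a`: the unique `b ∈ N` having the same right divisors lying in `N`
as `a` (w.r.t. the divisibility of the ambient monoid `M`). -/
noncomputable def tail (M N : Submonoid G) (a : G) : G :=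
  if h : ∃ b : G, b ∈ N ∧
      {c : G | c ∈ N ∧ leR M c a} = {c : G | c ∈ N ∧ leR M c b} then
    h.choose
  else 1

/-- Iterated stripping of alternating tails: first the `M₁`-tail, then the `N`-tail, etc. -/
noncomputable def strip (M M₁ N : Submonoid G) : ℕ → G → G
  | 0, a => a
  | i + 1, a =>
      strip M M₁ N i a *
        (tail M (if i % 2 = 0 then M₁ else N) (strip M M₁ N i a))⁻¹

/-- The breadth of `a`: the length of the alternating form of `a`, i.e. the least `p ≥ 1`
such that stripping alternating tails `p` times reaches `1`. -/
noncomputable def bh (M M₁ N : Submonoid G) (a : G) : ℕ :=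
  sInf {p : ℕ | 1 ≤ p ∧ strip M M₁ N p a = 1}

/-- The depth of `a`: `(bh a - 1)/2` if `bh a` is odd, `bh a / 2` if `bh a` is even;
in both cases this is `bh a / 2` with natural division. -/
noncomputable def dpt (M M₁ N : Submonoid G) (a : G) : ℕ := bh M M₁ N a / 2

/-- `a ∈ M` is unmovable if `Δ` does not right-divide it. -/
def Unmovable (M : Submonoid G) (Δ a : G) : Prop := a ∈ M ∧ ¬ leR M Δ a

/-- `α` is `(H, G₁)`-negative: its `Δ`-form is `a Δ^{-k}` with `k ≥ 1` and
`dpt a < dpt (Δ^k)`. -/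
def Negative (M M₁ N : Submonoid G) (Δ : G) (α : G) : Prop :=
  ∃ a : G, ∃ k : ℕ, Unmovable M Δ a ∧ 1 ≤ k ∧ α = a * (Δ ^ k)⁻¹ ∧
    dpt M M₁ N a < dpt M M₁ N (Δ ^ k)

/-- `α` is `(H, G₁)`-positive if `α⁻¹` is `(H, G₁)`-negative. -/
def Positive (M M₁ N : Submonoid G) (Δ : G) (α : G) : Prop :=
  Negative M M₁ N Δ α⁻¹

/-- The set `Θ` of theta elements `θ^k a₀`, `k ≥ 1`, `a₀ ∈ M₁`. -/
def thetaSet (M₁ : Submonoid G) (θ : G) : Set G :=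
  {x : G | ∃ k : ℕ, 1 ≤ k ∧ ∃ a₀ ∈ M₁, x = θ ^ k * a₀}

/-- `Θ̄ = Θ ∪ M₁`. -/
def thetaBar (M₁ : Submonoid G) (θ : G) : Set G := thetaSet M₁ θ ∪ (M₁ : Set G)

/-- Condition A with constant `ζ`: `dpt (Δ^k) = ζ k + 1` for all `k ≥ 1`. -/
def CondA (M M₁ N : Submonoid G) (Δ : G) (ζ : ℕ) : Prop :=
  ∀ k : ℕ, 1 ≤ k → dpt M M₁ N (Δ ^ k) = ζ * k + 1

/-- Condition B with constant `ζ`. -/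
def CondB (M M₁ N : Submonoid G) (Δ θ : G) (ζ : ℕ) : Prop :=
  ∀ a b c : G, ∀ t : ℤ,
    Unmovable M Δ a → Unmovable M Δ b →
    ¬(a ∈ thetaBar M₁ θ ∧ b ∈ thetaBar M₁ θ) →
    Unmovable M Δ c → a * b = c * Δ ^ t →
    ∃ ε : ℕ, ε ≤ 1 ∧
      (dpt M M₁ N c : ℤ) =
        (dpt M M₁ N a : ℤ) + (dpt M M₁ N b : ℤ) - (ζ : ℤ) * t - (ε : ℤ) ∧
      ((a ∈ thetaSet M₁ θ ∨ b ∈ thetaSet M₁ θ ∨ c ∈ M₁) → ε = 1)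

/-- A Garside structure with group of fractions the subgroup `car`. -/
structure IsGarsideOn (car : Subgroup G) (M : Submonoid G) (Δ : G) : Prop where
  M_sub : (M : Set G) ⊆ (car : Set G)
  delta_mem : Δ ∈ M
  units_trivial : ∀ x : G, x ∈ M → x⁻¹ ∈ M → x = 1
  noetherian : ∀ a ∈ M, ∃ n : ℕ, 1 ≤ n ∧ ∀ l : List G,
      (∀ x ∈ l, x ∈ M ∧ x ≠ 1) → l.prod = a → l.length ≤ n
  balanced : Balanced M Δ
  div_finite : (DivR M Δ).Finite
  div_gen_monoid : Submonoid.closure (DivR M Δ) = M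
  div_gen_group : Subgroup.closure (DivR M Δ) = car
  meet : ∀ a ∈ car, ∀ b ∈ car, ∃ c ∈ car, leR M c a ∧ leR M c b ∧
      ∀ d ∈ car, leR M d a → leR M d b → leR M d c
  join : ∀ a ∈ car, ∀ b ∈ car, ∃ c ∈ car, leR M a c ∧ leR M b c ∧
      ∀ d ∈ car, leR M a d → leR M b d → leR M c d

/-- The parabolic submonoid determined by `δ`: the submonoid generated by `Div(δ)`. -/
def parM (M : Submonoid G) (δ : G) : Submonoid G := Submonoid.closure (DivR M δ)

/-- The parabolic subgroup determined by `δ`: the subgroup generated by `Div(δ)`. -/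
def parG (M : Submonoid G) (δ : G) : Subgroup G := Subgroup.closure (DivR M δ)

/-- `δ` determines a parabolic substructure of `(G, M, Δ)`. -/
structure IsParabolic (M : Submonoid G) (Δ δ : G) : Prop where
  mem : δ ∈ M
  balanced : Balanced M δ
  div_eq : DivR M δ = DivR M Δ ∩ (parM M δ : Set G)

/-- The setting of Section 3: a Garside structure `(car, M, Δ)` together with two
parabolic substructures `(H, N, Λ)` (given by `lam`) and `(G₁, M₁, Δ₁)` (given by `δ1`),
with `N ≠ M`, `M₁ ≠ M`, `N ∪ M₁` generating `M`, `Δ` central, `Δ₁` central in `G₁`. -/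
structure Setting (G : Type*) [Group G] where
  car : Subgroup G
  M : Submonoid G
  Δ : G
  δ1 : G
  lam : G
  garside : IsGarsideOn car M Δ
  par1 : IsParabolic M Δ δ1
  parH : IsParabolic M Δ lam
  N_ne : parM M lam ≠ M
  M1_ne : parM M δ1 ≠ M
  unionGen : Submonoid.closure ((parM M lam : Set G) ∪ (parM M δ1 : Set G)) = M
  delta_central : ∀ g ∈ car, Δ * g = g * Δ
  delta1_central : ∀ g ∈ parG M δ1, δ1 * g = g * δ1

namespace Setting

variable (S : Setting G)

/-- The parabolic submonoid `M₁`. -/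
def M₁ : Submonoid G := parM S.M S.δ1

/-- The parabolic submonoid `N`. -/
def Nsub : Submonoid G := parM S.M S.lam

/-- The parabolic subgroup `G₁`. -/
def G₁ : Subgroup G := parG S.M S.δ1

/-- `θ = Δ Δ₁⁻¹`. -/
def theta : G := S.Δ * S.δ1⁻¹

/-- The set of `(H, G₁)`-negative elements. -/
def Neg : Set G := {α : G | Negative S.M S.M₁ S.Nsub S.Δ α}

/-- The set of `(H, G₁)`-positive elements. -/
def Pos : Set G := {α : G | α⁻¹ ∈ S.Neg}

/-- Condition A. -/
def condA (ζ : ℕ) : Prop := CondA S.M S.M₁ S.Nsub S.Δ ζ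

/-- Condition B. -/
def condB (ζ : ℕ) : Prop := CondB S.M S.M₁ S.Nsub S.Δ S.theta ζ

/-- `(H, G₁)` is a Dehornoy structure: `PP ⊆ P`, `G₁ P G₁ ⊆ P`, and the group is the
disjoint union of `P`, `P⁻¹` and `G₁`. -/
def IsDehornoy : Prop :=
  (∀ α ∈ S.Pos, ∀ β ∈ S.Pos, α * β ∈ S.Pos) ∧
  (∀ g₁ ∈ S.G₁, ∀ α ∈ S.Pos, ∀ g₂ ∈ S.G₁, g₁ * α * g₂ ∈ S.Pos) ∧
  (∀ α ∈ S.car, α ∈ S.Pos ∨ α ∈ S.Neg ∨ α ∈ S.G₁) ∧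
  (∀ α : G, ¬(α ∈ S.Pos ∧ α ∈ S.Neg)) ∧
  (∀ α : G, ¬(α ∈ S.Pos ∧ α ∈ S.G₁)) ∧
  (∀ α : G, ¬(α ∈ S.Neg ∧ α ∈ S.G₁))

end Setting

end GarsideOrder

namespace GarsideOrder

section Divisibility

variable {G : Type*} [Group G] {M : Submonoid G}

theorem leR_mul_right_iff {a b c : G} : leR M (a * c) (b * c) ↔ leR M a b := by
  simp [leR, mul_assoc]

theorem leR_mul_left {a c : G} (hc : c ∈ M) : leR M a (c * a) := by
  simpa [leR] using hc

theorem leR_refl (a : G) : leR M a a := by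
  simp [leR]

theorem leR_trans {a b c : G} (hab : leR M a b) (hbc : leR M b c) : leR M a c := by
  have := M.mul_mem hbc hab
  simpa [leR, mul_assoc] using this

theorem one_leR {a : G} (ha : a ∈ M) : leR M 1 a := by
  simpa [leR] using ha

theorem mem_of_leR {a b : G} (ha : a ∈ M) (hab : leR M a b) : b ∈ M := by
  have := M.mul_mem hab ha
  simpa [leR, mul_assoc] using this

theorem leR_mul_inv {a b c : G} (h : leR M (a * c) b) : leR M a (b * c⁻¹) := by
  simpa [leR, mul_assoc] using h

theorem leR_antisymm {car : Subgroup G} {Δ : G} (hg : IsGarsideOn car M Δ) {a b : G}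
    (hab : leR M a b) (hba : leR M b a) : a = b := by
  have := hg.units_trivial (b * a⁻¹) hab (by simpa [leR] using hba)
  exact (mul_inv_eq_one.mp this).symm

theorem Balanced.leR_of_leL {δ a : G} (hb : Balanced M δ) (ha : a ∈ M) (h : leL M a δ) :
    leR M a δ := by
  have : a ∈ DivL M δ := ⟨ha, h⟩
  rw [← hb] at this
  exact this.2

theorem Balanced.leL_of_leR {δ a : G} (hb : Balanced M δ) (ha : a ∈ M) (h : leR M a δ) :
    leL M a δ := by
  have : a ∈ DivR M δ := ⟨ha, h⟩
  rw [hb] at this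
  exact this.2

/-- Left factors of divisors of a balanced element are divisors. -/
theorem Balanced.left_factor_mem {δ a b : G} (hb : Balanced M δ) (ha : a ∈ M) (hbM : b ∈ M)
    (h : leR M (a * b) δ) : a ∈ DivR M δ := by
  refine ⟨ha, hb.leR_of_leL ha ?_⟩
  have h1 := hb.leL_of_leR (M.mul_mem ha hbM) h
  have := M.mul_mem hbM h1
  simpa [leL, mul_assoc] using this

/-- A balanced element `δ` normalizes its set of divisors. -/
theorem Balanced.exists_mul_eq_mul {δ s : G} (hb : Balanced M δ)
    (hs : s ∈ DivR M δ) : ∃ s' ∈ DivR M δ, δ * s = s' * δ := by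
  have ht : δ * s⁻¹ ∈ DivR M δ := by
    have := hb.left_factor_mem (b := s) hs.2 hs.1 (by simpa using leR_refl δ)
    exact this
  have hs' : δ * (δ * s⁻¹)⁻¹ ∈ DivR M δ :=
    hb.left_factor_mem (b := δ * s⁻¹) ht.2 ht.1
      (by rw [inv_mul_cancel_right]; exact leR_refl δ)
  exact ⟨_, hs', by group⟩

theorem Balanced.exists_pow_mul_eq_mul {δ s : G} (hb : Balanced M δ)
    (hs : s ∈ DivR M δ) (n : ℕ) : ∃ s' ∈ DivR M δ, δ ^ n * s = s' * δ ^ n := by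
  induction n with
  | zero => exact ⟨s, hs, by simp⟩
  | succ n ih =>
    obtain ⟨u, hu, hu'⟩ := ih
    obtain ⟨v, hv, hv'⟩ := hb.exists_mul_eq_mul hu
    refine ⟨v, hv, ?_⟩
    rw [pow_succ', mul_assoc, hu', ← mul_assoc, hv', mul_assoc]

end Divisibility

section Parabolic

variable {G : Type*} [Group G] {M : Submonoid G} {Δ δ : G}

theorem parM_le : parM M δ ≤ M :=
  (Submonoid.closure_le).2 fun _ hx => hx.1

theorem mem_parM_of_mem_DivR {s : G} (hs : s ∈ DivR M δ) : s ∈ parM M δ :=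
  Submonoid.subset_closure hs

theorem IsParabolic.self_mem (hp : IsParabolic M Δ δ) : δ ∈ parM M δ :=
  mem_parM_of_mem_DivR ⟨hp.mem, leR_refl δ⟩

theorem IsParabolic.leR_delta (hp : IsParabolic M Δ δ) {s : G} (hs : s ∈ DivR M δ) :
    s ∈ DivR M Δ := by
  rw [hp.div_eq] at hs
  exact hs.1

/-- A simple right divisor `s` of an element `x` of a parabolic submonoid is a divisor of `δ`,
and the quotient of `x` by `s` stays in the parabolic submonoid. -/
theorem IsParabolic.simple_divisor (hg : IsGarsideOn ⊤ M Δ) (hp : IsParabolic M Δ δ) {x : G}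
    (hx : x ∈ parM M δ) :
    ∀ s ∈ DivR M Δ, leR M s x → s ∈ DivR M δ ∧ x * s⁻¹ ∈ parM M δ := by
  induction hx using Submonoid.closure_induction_right with
  | one =>
    intro s hs h
    have : s = 1 := hg.units_trivial s hs.1 (by simpa [leR] using h)
    subst this
    exact ⟨⟨M.one_mem, one_leR hp.mem⟩, by simp⟩
  | mul_right x hx u hu ih =>
    intro s hs h
    obtain ⟨j, -, hsj, huj, hj⟩ := hg.join s trivial u trivial
    have huΔ := hp.leR_delta hu
    have hjΔ : leR M j Δ := hj Δ trivial hs.2 huΔ.2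
    have hjx : leR M j (x * u) := hj _ trivial h (leR_mul_left (parM_le hx))
    have hjM : j ∈ M := mem_of_leR hu.1 huj
    have hqΔ : j * u⁻¹ ∈ DivR M Δ :=
      hg.balanced.left_factor_mem (b := u) huj hu.1 (by simpa using hjΔ)
    have hqx : leR M (j * u⁻¹) x := by
      have := hjx
      simpa [leR, mul_assoc] using this
    obtain ⟨hq, hxq⟩ := ih _ hqΔ hqx
    have hjδ : j ∈ DivR M δ := by
      rw [hp.div_eq]
      refine ⟨⟨hjM, hjΔ⟩, ?_⟩
      have := (parM M δ).mul_mem (mem_parM_of_mem_DivR hq) (mem_parM_of_mem_DivR hu)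
      simpa using this
    have hsδ : s ∈ DivR M δ := ⟨hs.1, leR_trans hsj hjδ.2⟩
    have hpδ : j * s⁻¹ ∈ DivR M δ :=
      hp.balanced.left_factor_mem (b := s) hsj hs.1 (by simpa using hjδ.2)
    refine ⟨hsδ, ?_⟩
    have := (parM M δ).mul_mem hxq (mem_parM_of_mem_DivR hpδ)
    simpa [mul_assoc] using this

/-- Parabolic submonoids are closed under right divisors and the corresponding quotients. -/
theorem IsParabolic.divisor_closed (hg : IsGarsideOn ⊤ M Δ) (hp : IsParabolic M Δ δ) {y : G}
    (hy : y ∈ M) :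
    ∀ x ∈ parM M δ, leR M y x → y ∈ parM M δ ∧ x * y⁻¹ ∈ parM M δ := by
  rw [← hg.div_gen_monoid] at hy
  induction hy using Submonoid.closure_induction_right with
  | one => intro x hx _; exact ⟨one_mem _, by simpa using hx⟩
  | mul_right y hy s hs ih =>
    intro x hx h
    rw [hg.div_gen_monoid] at hy
    obtain ⟨h1, h2⟩ := hp.simple_divisor hg hx s hs (leR_trans (leR_mul_left hy) h)
    obtain ⟨h3, h4⟩ := ih _ h2 (leR_mul_inv h)
    exact ⟨mul_mem h3 (mem_parM_of_mem_DivR h1), by simpa [mul_assoc] using h4⟩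

theorem exists_leR_delta_pow (hg : IsGarsideOn ⊤ M Δ) (hc : ∀ g, Commute Δ g) {x : G}
    (hx : x ∈ M) : ∃ p : ℕ, leR M x (Δ ^ p) := by
  rw [← hg.div_gen_monoid] at hx
  induction hx using Submonoid.closure_induction_right with
  | one => exact ⟨0, by simpa using leR_refl 1⟩
  | mul_right x hx s hs ih =>
    obtain ⟨p, hp⟩ := ih
    refine ⟨p + 1, leR_trans (leR_mul_right_iff.2 hp) ?_⟩
    rw [((hc s).pow_left p).eq, pow_succ', leR_mul_right_iff]
    exact hs.2

theorem IsParabolic.leR_pow (hg : IsGarsideOn ⊤ M Δ) (hc : ∀ g, Commute Δ g)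
    (hp : IsParabolic M Δ δ) (p : ℕ) :
    ∀ x ∈ parM M δ, leR M x (Δ ^ p) → leR M x (δ ^ p) := by
  induction p with
  | zero => simp
  | succ p ih =>
    intro x hx h
    obtain ⟨s, -, hsx, hsΔ, hs⟩ := hg.meet x trivial Δ trivial
    have hsM : s ∈ M := by
      have := hs 1 trivial (one_leR (parM_le hx)) (one_leR hg.delta_mem)
      simpa [leR] using this
    obtain ⟨hsδ, hq⟩ := hp.simple_divisor hg hx s ⟨hsM, hsΔ⟩ hsx
    -- `x ≤ Δ ^ p * s`, because `Δ ^ p * s` is the meet of `Δ ^ p * x` and `Δ ^ (p + 1)`.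
    have hle : leR M (x * (Δ ^ p)⁻¹) s := by
      refine hs _ trivial ?_ ?_
      · have := pow_mem hg.delta_mem p
        simpa [leR, ((hc x⁻¹).pow_left p).eq] using this
      · simpa [leR, pow_succ', mul_assoc] using h
    have hle' : leR M (x * s⁻¹) (Δ ^ p) := by
      have h1 : leR M (x * s⁻¹ * s * (Δ ^ p)⁻¹) (Δ ^ p * s * (Δ ^ p)⁻¹) := by
        simpa [((hc s).pow_left p).eq] using hle
      rwa [leR_mul_right_iff, leR_mul_right_iff] at h1
    have h2 := ih _ hq hle'
    obtain ⟨s', hs', he⟩ := hp.balanced.exists_pow_mul_eq_mul hsδ p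
    have h3 : leR M x (δ ^ p * s) := by
      have := (leR_mul_right_iff (c := s)).2 h2
      simpa using this
    refine leR_trans h3 ?_
    rw [he, pow_succ', leR_mul_right_iff]
    exact hs'.2

theorem IsParabolic.exists_leR_pow (hg : IsGarsideOn ⊤ M Δ) (hc : ∀ g, Commute Δ g)
    (hp : IsParabolic M Δ δ) {x : G} (hx : x ∈ parM M δ) : ∃ p : ℕ, leR M x (δ ^ p) := by
  obtain ⟨p, h⟩ := exists_leR_delta_pow hg hc (parM_le hx)
  exact ⟨p, hp.leR_pow hg hc p x hx h⟩

/-- Characterization of the tail. -/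
theorem tail_eq {N : Submonoid G} (hg : IsGarsideOn ⊤ M Δ) {a b : G} (hb : b ∈ N)
    (hba : leR M b a) (h : ∀ c ∈ N, leR M c a → leR M c b) : tail M N a = b := by
  have hex : ∃ b : G, b ∈ N ∧
      {c : G | c ∈ N ∧ leR M c a} = {c : G | c ∈ N ∧ leR M c b} := by
    refine ⟨b, hb, ?_⟩
    ext c
    exact ⟨fun hc => ⟨hc.1, h c hc.1 hc.2⟩, fun hc => ⟨hc.1, leR_trans hc.2 hba⟩⟩
  rw [tail, dif_pos hex]
  obtain ⟨h1, h2⟩ := hex.choose_spec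
  have h3 : b ∈ {c : G | c ∈ N ∧ leR M c hex.choose} := h2.le ⟨hb, hba⟩
  have h4 : hex.choose ∈ {c : G | c ∈ N ∧ leR M c a} := h2.ge ⟨h1, leR_refl _⟩
  exact leR_antisymm hg (h _ h1 h4.2) h3.2

theorem IsParabolic.tail_spec (hg : IsGarsideOn ⊤ M Δ) (hc : ∀ g, Commute Δ g)
    (hp : IsParabolic M Δ δ) {a : G} (ha : a ∈ M) :
    tail M (parM M δ) a ∈ parM M δ ∧ leR M (tail M (parM M δ) a) a ∧
      ∀ c ∈ parM M δ, leR M c a → leR M c (tail M (parM M δ) a) := by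
  obtain ⟨p, h⟩ := exists_leR_delta_pow hg hc ha
  obtain ⟨b, -, hba, hbδ, hb⟩ := hg.meet a trivial (δ ^ p) trivial
  have hbM : b ∈ M := by
    have := hb 1 trivial (one_leR ha) (one_leR (pow_mem hp.mem p))
    simpa [leR] using this
  have hbN := (hp.divisor_closed hg hbM _ (pow_mem hp.self_mem p) hbδ).1
  have hmax : ∀ c ∈ parM M δ, leR M c a → leR M c b := fun c hcN hca =>
    hb c trivial hca (hp.leR_pow hg hc p c hcN (leR_trans hca h))
  rw [tail_eq hg hbN hba hmax]
  exact ⟨hbN, hba, hmax⟩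

end Parabolic

end GarsideOrder

namespace GarsideOrder

namespace Setting

variable {G : Type*} [Group G] (S : Setting G)

/-- The depth function of the setting. -/
noncomputable def depth (a : G) : ℕ := dpt S.M S.M₁ S.Nsub a

variable {S}

theorem garside_top (hcar : S.car = ⊤) : IsGarsideOn ⊤ S.M S.Δ := hcar ▸ S.garside

theorem commute_delta (hcar : S.car = ⊤) (g : G) : Commute S.Δ g :=
  S.delta_central g (hcar ▸ Subgroup.mem_top g)

theorem M₁_le : S.M₁ ≤ S.M := parM_le

theorem mem_G₁_of_mem_M₁ {x : G} (hx : x ∈ S.M₁) : x ∈ S.G₁ := by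
  have : S.M₁ ≤ S.G₁.toSubmonoid := (Submonoid.closure_le).2 Subgroup.subset_closure
  exact this hx

theorem commute_delta1 {g : G} (hgG : g ∈ S.G₁) : Commute S.δ1 g := S.delta1_central g hgG

theorem delta1_mem_M₁ : S.δ1 ∈ S.M₁ := S.par1.self_mem

theorem theta_mem : S.theta ∈ S.M :=
  (S.par1.leR_delta ⟨S.par1.mem, leR_refl _⟩).2

theorem commute_theta (hcar : S.car = ⊤) {g : G} (hgG : g ∈ S.G₁) : Commute S.theta g :=
  (commute_delta hcar g).mul_left (commute_delta1 hgG).inv_left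

theorem theta_pow_mul_delta1_pow (hcar : S.car = ⊤) (k : ℕ) :
    S.theta ^ k * S.δ1 ^ k = S.Δ ^ k := by
  rw [← (commute_theta hcar (mem_G₁_of_mem_M₁ delta1_mem_M₁)).mul_pow]
  simp [theta]

theorem delta_not_mem_M₁ : S.Δ ∉ S.M₁ := by
  intro h
  have hΔ : S.Δ ∈ DivR S.M S.Δ := ⟨S.garside.delta_mem, leR_refl _⟩
  have hmem : S.Δ ∈ DivR S.M S.δ1 := by
    rw [S.par1.div_eq]
    exact ⟨hΔ, h⟩
  refine S.M1_ne (le_antisymm parM_le ?_)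
  conv_lhs => rw [← S.garside.div_gen_monoid]
  exact (Submonoid.closure_le).2 fun x hx =>
    mem_parM_of_mem_DivR ⟨hx.1, leR_trans hx.2 hmem.2⟩

theorem unmovable_of_mem_M₁ (hcar : S.car = ⊤) {x : G} (hx : x ∈ S.M₁) :
    Unmovable S.M S.Δ x :=
  ⟨M₁_le hx, fun h => delta_not_mem_M₁
    (S.par1.divisor_closed (garside_top hcar) S.garside.delta_mem x hx h).1⟩

/-- Elements of `M₁` right-dividing `θ ^ k * a₀` right-divide `a₀`. -/
theorem leR_of_leR_theta_pow_mul (hcar : S.car = ⊤) (k : ℕ) {a₀ c : G} (ha : a₀ ∈ S.M₁)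
    (hcM : c ∈ S.M₁) (h : leR S.M c (S.theta ^ k * a₀)) : leR S.M c a₀ := by
  have hg := garside_top hcar
  have hc := commute_delta hcar
  obtain ⟨p, hp⟩ := S.par1.exists_leR_pow hg hc hcM
  obtain ⟨q, hq⟩ := S.par1.exists_leR_pow hg hc ha
  obtain ⟨j, -, hcj, haj, hj⟩ := hg.join c trivial a₀ trivial
  have hpow : ∀ m n : ℕ, leR S.M (S.δ1 ^ m) (S.δ1 ^ (n + m)) := fun m n => by
    rw [pow_add]
    exact leR_mul_left (pow_mem S.par1.mem n)
  have hjpq : leR S.M j (S.δ1 ^ (p + q)) := by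
    refine hj _ trivial (leR_trans hp ?_) (leR_trans hq (hpow q p))
    rw [add_comm]
    exact hpow p q
  have hjM : j ∈ S.M₁ :=
    (S.par1.divisor_closed hg (mem_of_leR (M₁_le hcM) hcj) _
      (pow_mem delta1_mem_M₁ _) hjpq).1
  have hd : j * a₀⁻¹ ∈ S.M₁ := (S.par1.divisor_closed hg (M₁_le ha) j hjM haj).2
  have hdθ : leR S.M (j * a₀⁻¹) (S.theta ^ k) := by
    have := hj _ trivial h (leR_mul_left (pow_mem theta_mem k))
    simpa [leR, mul_assoc] using this
  have hle : leR S.M (j * a₀⁻¹ * S.δ1 ^ k) (S.δ1 ^ k) := by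
    refine S.par1.leR_pow hg hc k _ (mul_mem hd (pow_mem delta1_mem_M₁ k)) ?_
    rw [← theta_pow_mul_delta1_pow hcar k, leR_mul_right_iff]
    exact hdθ
  have hone : j * a₀⁻¹ = 1 := by
    refine hg.units_trivial _ (M₁_le hd) ?_
    simpa [leR] using hle
  rwa [mul_inv_eq_one.mp hone] at hcj

theorem tail_theta_pow_mul (hcar : S.car = ⊤) (k : ℕ) {a₀ : G} (ha : a₀ ∈ S.M₁) :
    tail S.M S.M₁ (S.theta ^ k * a₀) = a₀ :=
  tail_eq (garside_top hcar) ha (leR_mul_left (pow_mem theta_mem k))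
    fun _ hc h => leR_of_leR_theta_pow_mul hcar k ha hc h

theorem unmovable_theta_pow_mul (hcar : S.car = ⊤) (k : ℕ) {a₀ : G} (ha : a₀ ∈ S.M₁)
    (h : ¬ leR S.M S.δ1 a₀) : Unmovable S.M S.Δ (S.theta ^ k * a₀) :=
  ⟨mul_mem (pow_mem theta_mem k) (M₁_le ha), fun hΔ => h <|
    leR_of_leR_theta_pow_mul hcar k ha delta1_mem_M₁ <|
      leR_trans (S.par1.leR_delta ⟨S.par1.mem, leR_refl _⟩).2 hΔ⟩

theorem depth_of_mem_M₁ (hcar : S.car = ⊤) {a : G} (ha : a ∈ S.M₁) : S.depth a = 0 := by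
  have h : bh S.M S.M₁ S.Nsub a ≤ 1 := by
    refine Nat.sInf_le ⟨le_rfl, ?_⟩
    have := tail_theta_pow_mul hcar 0 ha
    rw [pow_zero, one_mul] at this
    simp [strip, this]
  unfold depth dpt
  omega

theorem strip_eq_of_strip_one_eq {a b : G}
    (h : strip S.M S.M₁ S.Nsub 1 a = strip S.M S.M₁ S.Nsub 1 b) (n : ℕ) :
    strip S.M S.M₁ S.Nsub (n + 1) a = strip S.M S.M₁ S.Nsub (n + 1) b := by
  induction n with
  | zero => exact h
  | succ n ih => rw [strip, ih, ← strip]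

theorem depth_theta_pow_mul (hcar : S.car = ⊤) (k : ℕ) {a₀ : G} (ha : a₀ ∈ S.M₁) :
    S.depth (S.theta ^ k * a₀) = S.depth (S.Δ ^ k) := by
  have h1 : strip S.M S.M₁ S.Nsub 1 (S.theta ^ k * a₀) =
      strip S.M S.M₁ S.Nsub 1 (S.Δ ^ k) := by
    have h := tail_theta_pow_mul hcar k (pow_mem delta1_mem_M₁ k)
    rw [← theta_pow_mul_delta1_pow hcar k]
    simp [strip, tail_theta_pow_mul hcar k ha, h]
  have h2 : {p : ℕ | 1 ≤ p ∧ strip S.M S.M₁ S.Nsub p (S.theta ^ k * a₀) = 1} =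
      {p : ℕ | 1 ≤ p ∧ strip S.M S.M₁ S.Nsub p (S.Δ ^ k) = 1} := by
    ext p
    refine and_congr_right fun hp => ?_
    obtain ⟨n, rfl⟩ := Nat.exists_eq_add_of_le' hp
    rw [strip_eq_of_strip_one_eq h1]
  unfold depth dpt bh
  rw [h2]

theorem exists_tail_ne_one (hcar : S.car = ⊤) {x : G} (hx : x ∈ S.M) (hne : x ≠ 1) :
    tail S.M S.M₁ x ≠ 1 ∨ tail S.M S.Nsub x ≠ 1 := by
  have hg := garside_top hcar
  have key : x = 1 ∨ ∃ c, (c ∈ S.M₁ ∨ c ∈ S.Nsub) ∧ c ≠ 1 ∧ leR S.M c x := by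
    have hx' := hx
    rw [← S.unionGen] at hx'
    clear hne hx
    induction hx' using Submonoid.closure_induction_right with
    | one => exact Or.inl rfl
    | mul_right y hy s hs ih =>
      rw [S.unionGen] at hy
      by_cases h : s = 1
      · simpa [h] using ih
      · exact Or.inr ⟨s, Or.symm hs, h, leR_mul_left hy⟩
  obtain h | ⟨c, hcN, hc1, hcx⟩ := key
  · exact absurd h hne
  have aux : ∀ δ : G, IsParabolic S.M S.Δ δ → c ∈ parM S.M δ → tail S.M (parM S.M δ) x ≠ 1 := by
    intro δ hp hcδ ht
    have := (hp.tail_spec hg (commute_delta hcar) hx).2.2 c hcδ hcx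
    rw [ht] at this
    exact hc1 (hg.units_trivial c (parM_le hcδ) (by simpa [leR] using this))
  exact hcN.imp (aux _ S.par1) (aux _ S.parH)

/-- Stripping two successive tails from a nontrivial element removes a nontrivial factor. -/
theorem exists_strip_add_two (hcar : S.car = ⊤) {a : G} (n : ℕ)
    (hs : strip S.M S.M₁ S.Nsub (2 * n) a ∈ S.M)
    (hne : strip S.M S.M₁ S.Nsub (2 * n) a ≠ 1) :
    strip S.M S.M₁ S.Nsub (2 * (n + 1)) a ∈ S.M ∧ ∃ y ∈ S.M, y ≠ 1 ∧
      strip S.M S.M₁ S.Nsub (2 * (n + 1)) a * y = strip S.M S.M₁ S.Nsub (2 * n) a := by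
  have hg := garside_top hcar
  have hc := commute_delta hcar
  have e1 : strip S.M S.M₁ S.Nsub (2 * n + 1) a = strip S.M S.M₁ S.Nsub (2 * n) a *
      (tail S.M S.M₁ (strip S.M S.M₁ S.Nsub (2 * n) a))⁻¹ := by
    rw [strip, if_pos (by omega)]
  have e2 : strip S.M S.M₁ S.Nsub (2 * (n + 1)) a = strip S.M S.M₁ S.Nsub (2 * n + 1) a *
      (tail S.M S.Nsub (strip S.M S.M₁ S.Nsub (2 * n + 1) a))⁻¹ := by
    rw [show 2 * (n + 1) = 2 * n + 1 + 1 by ring, strip, if_neg (by omega)]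
  generalize strip S.M S.M₁ S.Nsub (2 * (n + 1)) a = z at *
  generalize strip S.M S.M₁ S.Nsub (2 * n + 1) a = y at *
  generalize strip S.M S.M₁ S.Nsub (2 * n) a = x at *
  obtain ⟨h1, h2, -⟩ := S.par1.tail_spec hg hc hs
  have hy : y ∈ S.M := e1 ▸ h2
  obtain ⟨h3, h4, -⟩ := S.parH.tail_spec hg hc hy
  have hz : z ∈ S.M := e2 ▸ h4
  refine ⟨hz, tail S.M S.Nsub y * tail S.M S.M₁ x, mul_mem (parM_le h3) (parM_le h1), ?_, ?_⟩
  · intro hone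
    have ht : tail S.M S.M₁ x = 1 := by
      refine hg.units_trivial _ (parM_le h1) ?_
      rw [← eq_inv_of_mul_eq_one_left hone]
      exact parM_le h3
    have hyx : y = x := by simp [e1, ht]
    rw [ht, mul_one, hyx] at hone
    exact (exists_tail_ne_one hcar hs hne).elim (fun h => h ht) (fun h => h hone)
  · simp [e2, e1]

/-- Stripping alternating tails terminates. -/
theorem exists_strip_eq_one (hcar : S.car = ⊤) {a : G} (ha : a ∈ S.M) :
    ∃ p, 1 ≤ p ∧ strip S.M S.M₁ S.Nsub p a = 1 := by
  by_contra! hcon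
  have hne : ∀ n, strip S.M S.M₁ S.Nsub (2 * n) a ∈ S.M →
      strip S.M S.M₁ S.Nsub (2 * n) a ≠ 1 := by
    intro n hn
    rcases Nat.eq_zero_or_pos n with rfl | hpos
    · intro h
      rw [Nat.mul_zero, strip] at h
      subst h
      have := tail_theta_pow_mul hcar 0 S.M₁.one_mem
      rw [pow_zero, one_mul] at this
      exact hcon 1 le_rfl (by simp [strip, this])
    · exact hcon _ (by omega)
  have key : ∀ n, strip S.M S.M₁ S.Nsub (2 * n) a ∈ S.M ∧ ∃ l : List G,
      (∀ x ∈ l, x ∈ S.M ∧ x ≠ 1) ∧ l.length = n ∧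
        strip S.M S.M₁ S.Nsub (2 * n) a * l.prod = a := by
    intro n
    induction n with
    | zero => exact ⟨by simpa [strip] using ha, [], by simp [strip]⟩
    | succ n ih =>
      obtain ⟨h1, l, hl, hlen, hprod⟩ := ih
      obtain ⟨h2, y, hy, hy1, hmul⟩ := exists_strip_add_two hcar n h1 (hne n h1)
      refine ⟨h2, y :: l, ?_, by simp [hlen], ?_⟩
      · simpa using ⟨⟨hy, hy1⟩, fun x hx => hl x hx⟩
      · rw [List.prod_cons, ← mul_assoc, hmul, hprod]
  obtain ⟨n, -, hn⟩ := S.garside.noetherian a ha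
  obtain ⟨h1, l, hl, hlen, hprod⟩ := key n
  have := hn (strip S.M S.M₁ S.Nsub (2 * n) a :: l)
    (by simpa using ⟨⟨h1, hne n h1⟩, fun x hx => hl x hx⟩) (by simpa using hprod)
  simp [hlen] at this

theorem mem_M₁_of_depth_eq_zero (hcar : S.car = ⊤) {a : G} (ha : a ∈ S.M)
    (h : S.depth a = 0) : a ∈ S.M₁ := by
  have hmem : bh S.M S.M₁ S.Nsub a ∈ {p : ℕ | 1 ≤ p ∧ strip S.M S.M₁ S.Nsub p a = 1} :=
    Nat.sInf_mem (exists_strip_eq_one hcar ha)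
  obtain ⟨h1, h2⟩ := hmem
  have hone : bh S.M S.M₁ S.Nsub a = 1 := by
    unfold depth dpt at h
    omega
  rw [hone] at h2
  have h3 : a = tail S.M S.M₁ a := by
    simpa [strip, mul_inv_eq_one] using h2
  rw [h3]
  exact (S.par1.tail_spec (garside_top hcar) (commute_delta hcar) ha).1

end Setting

end GarsideOrder

namespace GarsideOrder

theorem exists_eq_mul_inv_pow {G : Type*} [Group G] {M : Submonoid G} {δ : G}
    (hb : Balanced M δ) (hc : ∀ g ∈ parG M δ, Commute δ g) {x : G} (hx : x ∈ parG M δ) :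
    ∃ a ∈ parM M δ, ∃ n : ℕ, x = a * (δ ^ n)⁻¹ := by
  induction hx using Subgroup.closure_induction_right with
  | one => exact ⟨1, one_mem _, 0, by simp⟩
  | mul_right x hx y hy ih =>
    obtain ⟨a, ha, n, rfl⟩ := ih
    refine ⟨a * y, mul_mem ha (mem_parM_of_mem_DivR hy), n, ?_⟩
    rw [mul_assoc, mul_assoc, ((hc y (Subgroup.subset_closure hy)).pow_left n).inv_left.eq]
  | mul_inv_cancel x hx y hy ih =>
    obtain ⟨a, ha, n, rfl⟩ := ih
    have hyc := hc y (Subgroup.subset_closure hy)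
    have hq : δ * y⁻¹ ∈ DivR M δ := hb.left_factor_mem (b := y) hy.2 hy.1
      (by rw [inv_mul_cancel_right]; exact leR_refl δ)
    refine ⟨a * (δ * y⁻¹), mul_mem ha (mem_parM_of_mem_DivR hq), n + 1, ?_⟩
    rw [mul_assoc, (hyc.inv_right.pow_left n).inv_left.eq, hyc.inv_right.eq, pow_succ]
    simp [mul_assoc]

namespace Setting

variable {G : Type*} [Group G] {S : Setting G} {ζ : ℕ}

theorem delta_ne_one : S.Δ ≠ 1 := fun h => delta_not_mem_M₁ (h ▸ S.M₁.one_mem)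

theorem exists_unmovable_mul_pow {a : G} (ha : a ∈ S.M) :
    ∃ b, ∃ n : ℕ, Unmovable S.M S.Δ b ∧ a = b * S.Δ ^ n := by
  by_contra! hcon
  have key : ∀ n : ℕ, ∃ b ∈ S.M, a = b * S.Δ ^ n := by
    intro n
    induction n with
    | zero => exact ⟨a, ha, by simp⟩
    | succ n ih =>
      obtain ⟨b, hb, hab⟩ := ih
      have hΔ : leR S.M S.Δ b := by
        by_contra h
        exact hcon b n ⟨hb, h⟩ hab
      exact ⟨b * S.Δ⁻¹, hΔ, by rw [hab, pow_succ']; simp [mul_assoc]⟩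
  obtain ⟨n, -, hn⟩ := S.garside.noetherian a ha
  obtain ⟨b, hb, hab⟩ := key (n + 1)
  have hrep : ∀ x ∈ List.replicate (n + 1) S.Δ, x ∈ S.M ∧ x ≠ 1 := fun x hx => by
    rw [List.eq_of_mem_replicate hx]
    exact ⟨S.garside.delta_mem, delta_ne_one⟩
  by_cases h1 : b = 1
  · have := hn (List.replicate (n + 1) S.Δ) hrep (by simp [hab, h1])
    simp at this
  · have := hn (b :: List.replicate (n + 1) S.Δ)
      (List.forall_mem_cons.2 ⟨⟨hb, h1⟩, hrep⟩) (by simp [hab])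
    simp at this

/-- Existence of the `Δ`-form. -/
theorem exists_delta_form (hcar : S.car = ⊤) (α : G) :
    ∃ a, ∃ k : ℤ, Unmovable S.M S.Δ a ∧ α = a * S.Δ ^ k := by
  have hα : α ∈ parG S.M S.Δ := by
    rw [parG, S.garside.div_gen_group, hcar]
    exact Subgroup.mem_top α
  obtain ⟨x, hx, m, rfl⟩ :=
    exists_eq_mul_inv_pow S.garside.balanced (fun g _ => commute_delta hcar g) hα
  obtain ⟨a, n, ha, rfl⟩ := exists_unmovable_mul_pow (parM_le hx)
  refine ⟨a, n - m, ha, ?_⟩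
  rw [zpow_sub, zpow_natCast, zpow_natCast, mul_assoc]

theorem delta_form_exponent_le {a b : G} {k l : ℤ} (ha : Unmovable S.M S.Δ a)
    (hb : Unmovable S.M S.Δ b) (h : a * S.Δ ^ k = b * S.Δ ^ l) : l ≤ k := by
  by_contra! hlt
  obtain ⟨n, hn⟩ := Int.eq_ofNat_of_zero_le (show 0 ≤ l - k - 1 by omega)
  refine ha.2 ?_
  have hab : a = b * S.Δ ^ n * S.Δ := by
    rw [← eq_mul_inv_iff_mul_eq, ← zpow_neg, mul_assoc, ← zpow_add] at h
    rw [h, show l + -k = (n : ℤ) + 1 by omega, zpow_add, zpow_natCast, zpow_one, mul_assoc]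
  rw [hab]
  exact leR_mul_left (mul_mem hb.1 (pow_mem S.garside.delta_mem n))

/-- Uniqueness of the `Δ`-form. -/
theorem delta_form_unique {a b : G} {k l : ℤ} (ha : Unmovable S.M S.Δ a)
    (hb : Unmovable S.M S.Δ b) (h : a * S.Δ ^ k = b * S.Δ ^ l) : a = b ∧ k = l := by
  have hkl : k = l :=
    le_antisymm (delta_form_exponent_le hb ha h.symm) (delta_form_exponent_le ha hb h)
  subst hkl
  exact ⟨mul_right_cancel h, rfl⟩

theorem mem_Neg_of_depth_le (hA : S.condA ζ) {a : G} {k : ℤ} (ha : Unmovable S.M S.Δ a)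
    (hk : 1 ≤ k) (h : (S.depth a : ℤ) ≤ ζ * k) : a * S.Δ ^ (-k) ∈ S.Neg := by
  obtain ⟨n, rfl⟩ := Int.eq_ofNat_of_zero_le (show 0 ≤ k by omega)
  refine ⟨a, n, ha, by exact_mod_cast hk, by simp, ?_⟩
  rw [hA n (by exact_mod_cast hk)]
  exact Nat.lt_succ_of_le (by exact_mod_cast h)

theorem exists_of_mem_Neg (hA : S.condA ζ) {α : G} (hα : α ∈ S.Neg) :
    ∃ a, ∃ k : ℤ, Unmovable S.M S.Δ a ∧ 1 ≤ k ∧ α = a * S.Δ ^ (-k) ∧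
      (S.depth a : ℤ) ≤ ζ * k := by
  obtain ⟨a, k, ha, hk, rfl, h⟩ := hα
  refine ⟨a, k, ha, by exact_mod_cast hk, by simp, ?_⟩
  rw [hA k hk] at h
  exact_mod_cast Nat.le_of_lt_succ h

theorem depth_theta_pow_mul_eq (hcar : S.car = ⊤) (hA : S.condA ζ) {k : ℕ} (hk : 1 ≤ k)
    {a₀ : G} (ha : a₀ ∈ S.M₁) : S.depth (S.theta ^ k * a₀) = ζ * k + 1 :=
  (depth_theta_pow_mul hcar k ha).trans (hA k hk)

/-- The `Δ`-form of an element of `G₁`. -/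
theorem exists_delta_form_of_mem_G₁ (hcar : S.car = ⊤) (hA : S.condA ζ) {g : G}
    (hgG : g ∈ S.G₁) : ∃ a, ∃ s : ℕ, Unmovable S.M S.Δ a ∧ g = a * S.Δ ^ (-(s : ℤ)) ∧
      ((a ∈ S.M₁ ∧ s = 0 ∧ S.depth a = 0) ∨
        (a ∈ thetaSet S.M₁ S.theta ∧ 1 ≤ s ∧ S.depth a = ζ * s + 1)) := by
  classical
  have hex : ∃ n : ℕ, ∃ x ∈ S.M₁, g = x * (S.δ1 ^ n)⁻¹ := by
    obtain ⟨x, hx, n, h⟩ := exists_eq_mul_inv_pow S.par1.balanced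
      (fun g hg => commute_delta1 hg) hgG
    exact ⟨n, x, hx, h⟩
  obtain ⟨x, hx, hxg⟩ := Nat.find_spec hex
  rcases hs : Nat.find hex with _ | s
  · rw [hs] at hxg
    refine ⟨x, 0, unmovable_of_mem_M₁ hcar hx, by simpa using hxg, Or.inl ⟨hx, rfl, ?_⟩⟩
    exact depth_of_mem_M₁ hcar hx
  · rw [hs] at hxg
    have hδ : ¬ leR S.M S.δ1 x := by
      intro h
      refine Nat.find_min hex (show s < Nat.find hex by omega) ⟨x * S.δ1⁻¹, ?_, ?_⟩
      · exact (S.par1.divisor_closed (garside_top hcar) S.par1.mem x hx h).2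
      · rw [hxg, pow_succ]
        group
    refine ⟨S.theta ^ (s + 1) * x, s + 1, unmovable_theta_pow_mul hcar _ hx hδ, ?_,
      Or.inr ⟨⟨s + 1, by omega, x, hx, rfl⟩, by omega, ?_⟩⟩
    · rw [zpow_neg, zpow_natCast, ← theta_pow_mul_delta1_pow hcar,
        ((commute_theta hcar (mem_G₁_of_mem_M₁ hx)).pow_left _).eq, hxg]
      have hcomm := ((commute_theta hcar (mem_G₁_of_mem_M₁ delta1_mem_M₁)).pow_pow
        (s + 1) (s + 1)).eq
      rw [hcomm]
      group
    · exact depth_theta_pow_mul_eq hcar hA (by omega) hx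

theorem exists_of_mem_thetaBar (hcar : S.car = ⊤) (hA : S.condA ζ) {a : G}
    (ha : a ∈ thetaBar S.M₁ S.theta) : ∃ g ∈ S.G₁, ∃ s : ℕ, a = g * S.Δ ^ (s : ℤ) ∧
      (s = 0 ∨ S.depth a = ζ * s + 1) := by
  obtain ⟨k, hk, a₀, ha₀, rfl⟩ | ha := ha
  · have h₁ := mem_G₁_of_mem_M₁ ha₀
    refine ⟨a₀ * (S.δ1 ^ k)⁻¹, mul_mem h₁ (inv_mem (pow_mem
      (mem_G₁_of_mem_M₁ delta1_mem_M₁) k)), k, ?_,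
      Or.inr (depth_theta_pow_mul_eq hcar hA hk ha₀)⟩
    rw [zpow_natCast, ← theta_pow_mul_delta1_pow hcar,
      ((commute_theta hcar h₁).pow_left k).eq,
      ((commute_theta hcar (mem_G₁_of_mem_M₁ delta1_mem_M₁)).pow_pow k k).eq]
    group
  · exact ⟨a, mem_G₁_of_mem_M₁ ha, 0, by simp, Or.inl rfl⟩

theorem mul_delta_zpow_mem_Neg (hcar : S.car = ⊤) (hζ : 1 ≤ ζ) (hA : S.condA ζ) {g : G}
    (hgG : g ∈ S.G₁) {n : ℤ} (hn : 1 ≤ n) : g * S.Δ ^ (-n) ∈ S.Neg := by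
  obtain ⟨a, s, ha, rfl, hs⟩ := exists_delta_form_of_mem_G₁ hcar hA hgG
  rw [mul_assoc, ← zpow_add, ← neg_add]
  refine mem_Neg_of_depth_le hA ha (by omega) ?_
  have h1 : (1 : ℤ) ≤ ζ := by exact_mod_cast hζ
  rcases hs with ⟨-, -, hd⟩ | ⟨-, -, hd⟩
  · rw [hd]
    push_cast
    positivity
  · rw [hd]
    push_cast
    nlinarith

theorem not_mem_G₁_of_mem_Neg (hcar : S.car = ⊤) (hA : S.condA ζ) {α : G}
    (hα : α ∈ S.Neg) : α ∉ S.G₁ := by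
  intro hα₁
  obtain ⟨a, k, ha, hk, rfl, hd⟩ := exists_of_mem_Neg hA hα
  obtain ⟨b, s, hb, h, hs⟩ := exists_delta_form_of_mem_G₁ hcar hA hα₁
  obtain ⟨rfl, hks⟩ := delta_form_unique ha hb h
  obtain rfl : k = s := by omega
  rcases hs with ⟨-, hs, -⟩ | ⟨-, -, hs⟩
  · omega
  · rw [hs] at hd
    push_cast at hd
    omega

theorem mul_mul_delta_zpow (hcar : S.car = ⊤) (a b : G) (k l : ℤ) :
    a * S.Δ ^ k * (b * S.Δ ^ l) = a * b * S.Δ ^ (k + l) := by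
  rw [zpow_add, mul_assoc, ← mul_assoc (S.Δ ^ k), ((commute_delta hcar b).zpow_left k).eq]
  simp only [mul_assoc]

/-- A negative element whose `Δ`-form starts in `Θ̄` lies in `G₁ * Δ ^ (-n)` with `n ≥ 1`. -/
theorem exists_mul_delta_zpow (hcar : S.car = ⊤) (hζ : 1 ≤ ζ) (hA : S.condA ζ) {a : G} {k : ℤ}
    (ha : a ∈ thetaBar S.M₁ S.theta) (hk : 1 ≤ k) (hd : (S.depth a : ℤ) ≤ ζ * k) :
    ∃ g ∈ S.G₁, ∃ n : ℤ, 1 ≤ n ∧ a * S.Δ ^ (-k) = g * S.Δ ^ (-n) := by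
  obtain ⟨g, hgG, s, h, hs⟩ := exists_of_mem_thetaBar hcar hA ha
  refine ⟨g, hgG, k - s, ?_, ?_⟩
  · rcases hs with rfl | hs
    · simpa using hk
    · rw [hs] at hd
      push_cast at hd
      by_contra! hlt
      have : (ζ : ℤ) * k ≤ ζ * s := mul_le_mul_of_nonneg_left (by omega) (by positivity)
      omega
  · rw [h, mul_assoc, ← zpow_add]
    congr 2
    ring

/-- The product of two elements whose `Δ`-forms satisfy the depth bounds is negative or lies
in `G₁`, the latter only in the extremal case. -/
theorem mul_mem_Neg_or_mem_G₁ (hcar : S.car = ⊤) (hζ : 1 ≤ ζ) (hA : S.condA ζ)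
    (hB : S.condB ζ) {a b : G} {k l : ℤ} (ha : Unmovable S.M S.Δ a) (hb : Unmovable S.M S.Δ b)
    (hab : ¬(a ∈ thetaBar S.M₁ S.theta ∧ b ∈ thetaBar S.M₁ S.theta))
    (hd : (S.depth a + S.depth b : ℤ) ≤ ζ * (k + l) ∨
      (a ∈ thetaSet S.M₁ S.theta ∨ b ∈ thetaSet S.M₁ S.theta) ∧
        (S.depth a + S.depth b : ℤ) ≤ ζ * (k + l) + 1) :
    a * S.Δ ^ (-k) * (b * S.Δ ^ (-l)) ∈ S.Neg ∨
      a * S.Δ ^ (-k) * (b * S.Δ ^ (-l)) ∈ S.G₁ ∧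
        (S.depth a + S.depth b : ℤ) = ζ * (k + l) + 1 := by
  obtain ⟨c, t, hc, hct⟩ := exists_delta_form hcar (a * b)
  obtain ⟨ε, hε, hdc, hε1⟩ := hB a b c t ha hb hab hc hct
  change (S.depth c : ℤ) = S.depth a + S.depth b - ζ * t - ε at hdc
  have hprod : a * S.Δ ^ (-k) * (b * S.Δ ^ (-l)) = c * S.Δ ^ (-(k + l - t)) := by
    rw [mul_mul_delta_zpow hcar, hct, mul_assoc, ← zpow_add]
    congr 2
    ring
  rw [hprod]
  have hle : (S.depth c : ℤ) ≤ ζ * (k + l - t) := by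
    rcases hd with hd | ⟨hθ, hd⟩
    · linarith
    · rw [hε1 (hθ.elim Or.inl fun h => Or.inr (Or.inl h))] at hdc
      push_cast at hdc
      linarith
  have hζ' : (0 : ℤ) < ζ := by exact_mod_cast hζ
  have hnonneg : 0 ≤ k + l - t :=
    nonneg_of_mul_nonneg_right (le_trans (Int.natCast_nonneg _) hle) hζ'
  rcases hnonneg.eq_or_lt with h0 | hpos
  · right
    rw [← h0, mul_zero] at hle
    have hc0 : S.depth c = 0 := by omega
    have hcM := mem_M₁_of_depth_eq_zero hcar hc.1 hc0
    rw [hε1 (Or.inr (Or.inr hcM)), hc0] at hdc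
    refine ⟨by simpa [← h0] using mem_G₁_of_mem_M₁ hcM, ?_⟩
    rw [show k + l = t by omega]
    push_cast at hdc
    linarith
  · exact Or.inl (mem_Neg_of_depth_le hA hc (by omega) hle)

theorem mul_mem_Neg (hcar : S.car = ⊤) (hζ : 1 ≤ ζ) (hA : S.condA ζ) (hB : S.condB ζ)
    {α β : G} (hα : α ∈ S.Neg) (hβ : β ∈ S.Neg) : α * β ∈ S.Neg := by
  obtain ⟨a, k, ha, hk, rfl, hda⟩ := exists_of_mem_Neg hA hα
  obtain ⟨b, l, hb, hl, rfl, hdb⟩ := exists_of_mem_Neg hA hβ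
  by_cases hab : a ∈ thetaBar S.M₁ S.theta ∧ b ∈ thetaBar S.M₁ S.theta
  · obtain ⟨g, hg, m, hm, h1⟩ := exists_mul_delta_zpow hcar hζ hA hab.1 hk hda
    obtain ⟨g', hg', n, hn, h2⟩ := exists_mul_delta_zpow hcar hζ hA hab.2 hl hdb
    rw [h1, h2, mul_mul_delta_zpow hcar, ← neg_add]
    exact mul_delta_zpow_mem_Neg hcar hζ hA (mul_mem hg hg') (by omega)
  · obtain h | ⟨-, h⟩ := mul_mem_Neg_or_mem_G₁ hcar hζ hA hB ha hb hab
      (Or.inl (show (_ : ℤ) ≤ ζ * (k + l) by linarith))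
    · exact h
    · linarith

theorem G₁_mul_mem_Neg (hcar : S.car = ⊤) (hζ : 1 ≤ ζ) (hA : S.condA ζ) (hB : S.condB ζ)
    {g α : G} (hg : g ∈ S.G₁) (hα : α ∈ S.Neg) : g * α ∈ S.Neg := by
  have hα₁ := not_mem_G₁_of_mem_Neg hcar hA hα
  obtain ⟨b, l, hb, hl, rfl, hdb⟩ := exists_of_mem_Neg hA hα
  by_cases hbθ : b ∈ thetaBar S.M₁ S.theta
  · obtain ⟨g', hg', n, hn, h⟩ := exists_mul_delta_zpow hcar hζ hA hbθ hl hdb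
    rw [h, ← mul_assoc]
    exact mul_delta_zpow_mem_Neg hcar hζ hA (mul_mem hg hg') hn
  · obtain ⟨a, s, ha, rfl, hs⟩ := exists_delta_form_of_mem_G₁ hcar hA hg
    refine (mul_mem_Neg_or_mem_G₁ hcar hζ hA hB ha hb (fun h => hbθ h.2) ?_).resolve_right
      fun h => hα₁ ((Subgroup.mul_mem_cancel_left _ hg).1 h.1)
    rcases hs with ⟨-, rfl, hd⟩ | ⟨haθ, -, hd⟩
    · left
      simpa [hd] using hdb
    · refine Or.inr ⟨Or.inl haθ, ?_⟩
      rw [hd]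
      push_cast
      linarith

theorem mul_G₁_mem_Neg (hcar : S.car = ⊤) (hζ : 1 ≤ ζ) (hA : S.condA ζ) (hB : S.condB ζ)
    {g α : G} (hg : g ∈ S.G₁) (hα : α ∈ S.Neg) : α * g ∈ S.Neg := by
  have hα₁ := not_mem_G₁_of_mem_Neg hcar hA hα
  obtain ⟨b, l, hb, hl, rfl, hdb⟩ := exists_of_mem_Neg hA hα
  by_cases hbθ : b ∈ thetaBar S.M₁ S.theta
  · obtain ⟨g', hg', n, hn, h⟩ := exists_mul_delta_zpow hcar hζ hA hbθ hl hdb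
    rw [h, mul_assoc, ((commute_delta hcar g).zpow_left _).eq, ← mul_assoc]
    exact mul_delta_zpow_mem_Neg hcar hζ hA (mul_mem hg' hg) hn
  · obtain ⟨a, s, ha, rfl, hs⟩ := exists_delta_form_of_mem_G₁ hcar hA hg
    refine (mul_mem_Neg_or_mem_G₁ hcar hζ hA hB hb ha (fun h => hbθ h.1) ?_).resolve_right
      fun h => hα₁ ((Subgroup.mul_mem_cancel_right _ hg).1 h.1)
    rcases hs with ⟨-, rfl, hd⟩ | ⟨haθ, -, hd⟩
    · left
      simpa [hd] using hdb
    · refine Or.inr ⟨Or.inr haθ, ?_⟩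
      rw [hd]
      push_cast
      linarith

theorem mem_of_eq_mul_delta_zpow (hcar : S.car = ⊤) (hζ : 1 ≤ ζ) (hA : S.condA ζ) {g : G}
    (hg : g ∈ S.G₁) (n : ℤ) :
    (g * S.Δ ^ n)⁻¹ ∈ S.Neg ∨ g * S.Δ ^ n ∈ S.Neg ∨ g * S.Δ ^ n ∈ S.G₁ := by
  rcases lt_trichotomy n 0 with hn | rfl | hn
  · refine Or.inr (Or.inl ?_)
    simpa using mul_delta_zpow_mem_Neg hcar hζ hA hg (n := -n) (by omega)
  · exact Or.inr (Or.inr (by simpa using hg))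
  · left
    rw [← ((commute_delta hcar g).zpow_left n).eq, mul_inv_rev, ← zpow_neg]
    exact mul_delta_zpow_mem_Neg hcar hζ hA (inv_mem hg) (by omega)

theorem inv_mem_Neg_or_mem_Neg_or_mem_G₁ (hcar : S.car = ⊤) (hζ : 1 ≤ ζ) (hA : S.condA ζ)
    (hB : S.condB ζ) (α : G) : α⁻¹ ∈ S.Neg ∨ α ∈ S.Neg ∨ α ∈ S.G₁ := by
  obtain ⟨a, k, ha, hαa⟩ := exists_delta_form hcar α
  obtain ⟨b, l, hb, hαb⟩ := exists_delta_form hcar α⁻¹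
  by_cases haθ : a ∈ thetaBar S.M₁ S.theta
  · obtain ⟨g, hg, s, h, -⟩ := exists_of_mem_thetaBar hcar hA haθ
    rw [hαa, h, mul_assoc, ← zpow_add]
    exact mem_of_eq_mul_delta_zpow hcar hζ hA hg _
  by_cases hbθ : b ∈ thetaBar S.M₁ S.theta
  · obtain ⟨g, hg, s, h, -⟩ := exists_of_mem_thetaBar hcar hA hbθ
    have h' := mem_of_eq_mul_delta_zpow hcar hζ hA hg (s + l)
    rw [zpow_add, ← mul_assoc, ← h, ← hαb, inv_inv, inv_mem_iff] at h'
    tauto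
  have hmul : a * b = 1 * S.Δ ^ (-(k + l)) := by
    have h : a * b * S.Δ ^ (k + l) = 1 := by
      rw [← mul_mul_delta_zpow hcar, ← hαa, ← hαb, mul_inv_cancel]
    rw [one_mul, zpow_neg]
    exact eq_inv_of_mul_eq_one_left h
  have hone := S.M₁.one_mem
  obtain ⟨ε, -, hd, hε⟩ := hB a b 1 _ ha hb (fun h => haθ h.1)
    (unmovable_of_mem_M₁ hcar hone) hmul
  change (S.depth 1 : ℤ) = S.depth a + S.depth b - ζ * -(k + l) - ε at hd
  rw [hε (Or.inr (Or.inr hone)), depth_of_mem_M₁ hcar hone] at hd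
  have hζ' : (0 : ℤ) < ζ := by exact_mod_cast hζ
  have hda : 0 < S.depth a := Nat.pos_of_ne_zero fun h =>
    haθ (Or.inr (mem_M₁_of_depth_eq_zero hcar ha.1 h))
  have hdb : 0 < S.depth b := Nat.pos_of_ne_zero fun h =>
    hbθ (Or.inr (mem_M₁_of_depth_eq_zero hcar hb.1 h))
  push_cast at hd
  by_cases hle : (S.depth a : ℤ) ≤ ζ * -k
  · refine Or.inr (Or.inl ?_)
    have hpos : 0 < -k := pos_of_mul_pos_right (by omega) hζ'.le
    have := mem_Neg_of_depth_le hA ha (by omega) hle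
    rwa [neg_neg, ← hαa] at this
  · left
    have hle' : (S.depth b : ℤ) ≤ ζ * -l := by
      push Not at hle
      linarith
    have hpos : 0 < -l := pos_of_mul_pos_right (by omega) hζ'.le
    have := mem_Neg_of_depth_le hA hb (by omega) hle'
    rwa [neg_neg, ← hαb] at this

end Setting

end GarsideOrder

open GarsideOrder in
/-- If there exists an integer `ζ ≥ 1` such that `(H, G₁)` satisfies Condition A with
constant `ζ` and Condition B with constant `ζ`, then `(H, G₁)` is a Dehornoy structure. -/
theorem statement0 {G : Type*} [Group G] (S : Setting G) (hcar : S.car = ⊤)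
    (h : ∃ ζ : ℕ, 1 ≤ ζ ∧ S.condA ζ ∧ S.condB ζ) :
    S.IsDehornoy := by
  obtain ⟨ζ, hζ, hA, hB⟩ := h
  have hdisj : ∀ α ∈ S.Neg, α ∉ S.G₁ := fun α hα =>
    Setting.not_mem_G₁_of_mem_Neg hcar hA hα
  refine ⟨fun α hα β hβ => ?_, fun g₁ hg₁ α hα g₂ hg₂ => ?_,
    fun α _ => Setting.inv_mem_Neg_or_mem_Neg_or_mem_G₁ hcar hζ hA hB α, fun α hα => ?_,
    fun α hα => hdisj _ hα.1 (inv_mem hα.2), fun α hα => hdisj _ hα.1 hα.2⟩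
  · change (α * β)⁻¹ ∈ S.Neg
    rw [mul_inv_rev]
    exact Setting.mul_mem_Neg hcar hζ hA hB hβ hα
  · change (g₁ * α * g₂)⁻¹ ∈ S.Neg
    rw [mul_inv_rev, mul_inv_rev]
    exact Setting.G₁_mul_mem_Neg hcar hζ hA hB (inv_mem hg₂)
      (Setting.mul_G₁_mem_Neg hcar hζ hA hB (inv_mem hg₁) hα)
  · refine hdisj 1 ?_ (one_mem _)
    simpa using Setting.mul_mem_Neg hcar hζ hA hB hα.1 hα.2
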